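/- Let $V$ be an $n$-dimensional vector space over $\mathbb{C}$ with $n \geq 2$, and let $f$ be a nilpotent endomorphism of $V$ with $f^{n-1} = 0$ (i.e., $f$ is not regular nilpotent). Then the set of complete flags $0 = V_0 \subsetneq V_1 \subsetneq \cdots \subsetneq V_n = V$ (with $\dim V_i = i$) satisfying $f(V_i) \subseteq V_i$ for all $i$ is infinite. -/

import Mathlib

open Module

section

variable {K V : Type*} [Field K] [AddCommGroup V] [Module K V]

theorem LinearMap.finrank_ker_comp_le [FiniteDimensional K V] (g f : V →ₗ[K] V) :
    finrank K (g ∘ₗ f).ker ≤ finrank K g.ker + finrank K f.ker := by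
  have hsum := (f.domRestrict (g ∘ₗ f).ker).finrank_range_add_finrank_ker
  have hrange : finrank K (f.domRestrict (g ∘ₗ f).ker).range ≤ finrank K g.ker := by
    refine Submodule.finrank_mono ?_
    rintro _ ⟨x, rfl⟩
    exact x.2
  have hker : finrank K (f.domRestrict (g ∘ₗ f).ker).ker ≤ finrank K f.ker := by
    rw [← Submodule.finrank_map_subtype_eq]
    refine Submodule.finrank_mono ?_
    rintro _ ⟨x, hx, rfl⟩
    exact hx
  omega

theorem LinearMap.finrank_ker_pow_le [FiniteDimensional K V] (f : V →ₗ[K] V) (k : ℕ) :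
    finrank K (f ^ k).ker ≤ k * finrank K f.ker := by
  induction k with
  | zero => simp [Module.End.one_eq_id]
  | succ k ih =>
    have h := LinearMap.finrank_ker_comp_le (f ^ k) f
    rw [← Module.End.mul_eq_comp, ← pow_succ] at h
    linarith

theorem LinearMap.one_lt_finrank_ker_of_pow_eq_zero [FiniteDimensional K V] (f : V →ₗ[K] V)
    {k : ℕ} (hk : k < finrank K V) (hf : f ^ k = 0) : 1 < finrank K f.ker := by
  by_contra! h
  have hle := f.finrank_ker_pow_le k
  rw [hf, LinearMap.ker_zero, finrank_top] at hle
  nlinarith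

/-- A proper invariant subspace of a nilpotent endomorphism misses a vector whose image lies in
the subspace. -/
theorem IsNilpotent.exists_notMem_map_mem {f : V →ₗ[K] V} (hf : IsNilpotent f)
    {W : Submodule K V} (hW : W ≠ ⊤) : ∃ v, v ∉ W ∧ f v ∈ W := by
  by_contra! h
  obtain ⟨v, hv⟩ : ∃ v, v ∉ W := by
    by_contra! h'
    exact hW (Submodule.eq_top_iff'.mpr h')
  have hpow : ∀ k, (f ^ k) v ∉ W := by
    intro k
    induction k with
    | zero => simpa using hv
    | succ k ih => simpa [pow_succ'] using h _ ih
  obtain ⟨k, hk⟩ := hf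
  exact hpow k (by simp [hk])

theorem IsNilpotent.exists_invariant_succ [FiniteDimensional K V] {f : V →ₗ[K] V}
    (hf : IsNilpotent f) (W : Submodule K V) (hW : W.map f ≤ W) :
    ∃ W' : Submodule K V, W ≤ W' ∧ W'.map f ≤ W' ∧
      finrank K W' = min (finrank K W + 1) (finrank K V) := by
  by_cases htop : W = ⊤
  · subst htop
    exact ⟨⊤, le_rfl, le_top, by simp⟩
  · obtain ⟨v, hv, hfv⟩ := hf.exists_notMem_map_mem htop
    have hlt := Submodule.finrank_lt (lt_top_iff_ne_top.mpr htop).ne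
    refine ⟨W ⊔ Submodule.span K {v}, le_sup_left, ?_, ?_⟩
    · rw [Submodule.map_sup, Submodule.map_span, Set.image_singleton]
      refine sup_le (hW.trans le_sup_left) (le_trans ?_ le_sup_left)
      rwa [Submodule.span_singleton_le_iff_mem]
    · rw [Submodule.finrank_sup_span_singleton hv]
      omega

/-- An invariant line of a nilpotent endomorphism extends to an invariant complete flag. -/
theorem IsNilpotent.exists_flag [FiniteDimensional K V] {f : V →ₗ[K] V}
    (hf : IsNilpotent f) (L : Submodule K V) (hL : L.map f ≤ L) (hL1 : finrank K L = 1) :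
    ∃ F : ℕ → Submodule K V, F 1 = L ∧ Monotone F ∧ (∀ k, (F k).map f ≤ F k) ∧
      ∀ k ≤ finrank K V, finrank K (F k) = k := by
  choose next hle hinv hrank using hf.exists_invariant_succ
  let G : ℕ → {W : Submodule K V // W.map f ≤ W} := fun k =>
    Nat.rec ⟨L, hL⟩ (fun _ W => ⟨next W.1 W.2, hinv W.1 W.2⟩) k
  have hG : ∀ k < finrank K V, finrank K (G k).1 = k + 1 := by
    intro k hk
    induction k with
    | zero => exact hL1
    | succ k ih =>
      have h := hrank (G k).1 (G k).2
      rw [ih (by omega)] at h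
      exact h.trans (by omega)
  refine ⟨fun k => Nat.casesOn k ⊥ fun k => (G k).1, rfl, monotone_nat_of_le_succ ?_, ?_, ?_⟩
  · rintro (_ | k)
    · exact bot_le
    · exact hle (G k).1 (G k).2
  · rintro (_ | k)
    · simp
    · exact (G k).2
  · rintro (_ | k) hk
    · simp
    · exact hG k hk

theorem LinearIndependent.injective_span_add_smul {u v : V}
    (h : LinearIndependent K ![u, v]) :
    Function.Injective fun c : K => Submodule.span K {u + c • v} := by
  intro c d hcd
  beta_reduce at hcd
  have hmem : u + c • v ∈ Submodule.span K {u + d • v} := by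
    exact hcd ▸ Submodule.mem_span_singleton_self (u + c • v)
  obtain ⟨a, ha⟩ := Submodule.mem_span_singleton.mp hmem
  obtain ⟨h1, h2⟩ := LinearIndependent.pair_iff.mp h (a - 1) (a * d - c) (by
    linear_combination (norm := module) ha)
  rw [sub_eq_zero.mp h1, one_mul] at h2
  exact (sub_eq_zero.mp h2).symm

end

/-- Let `V` be an `n`-dimensional complex vector space with `n ≥ 2` and
let `f` be a non-regular nilpotent endomorphism of `V` (i.e. `f ^ (n-1) = 0`). Then the set
of complete flags stabilized by `f` is infinite. -/
theorem fixed_points_stmt9 {V : Type*} [AddCommGroup V] [Module ℂ V]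
    [FiniteDimensional ℂ V] (n : ℕ) (hn2 : 2 ≤ n) (hn : finrank ℂ V = n)
    (f : V →ₗ[ℂ] V) (hnil : IsNilpotent f) (hnonreg : f ^ (n - 1) = 0) :
    {F : Fin (n + 1) → Submodule ℂ V |
        (∀ i, finrank ℂ (F i) = (i : ℕ)) ∧ Monotone F ∧
        ∀ i, Submodule.map f (F i) ≤ F i}.Infinite := by
  have hker := f.one_lt_finrank_ker_of_pow_eq_zero (by omega) hnonreg
  have : Nontrivial f.ker := nontrivial_of_finrank_pos (R := ℂ) (by omega)
  obtain ⟨u, hu⟩ := exists_ne (0 : f.ker)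
  obtain ⟨v, huv⟩ := exists_linearIndependent_pair_of_one_lt_finrank hker hu
  have hli : LinearIndependent ℂ ![(u : V), (v : V)] := by
    rw [LinearIndependent.pair_iff] at huv ⊢
    exact fun s t hst => huv s t (Subtype.ext hst)
  have hflag : ∀ c : ℂ, ∃ F : ℕ → Submodule ℂ V, F 1 = Submodule.span ℂ {(u : V) + c • (v : V)} ∧
      Monotone F ∧ (∀ k, (F k).map f ≤ F k) ∧ ∀ k ≤ finrank ℂ V, finrank ℂ (F k) = k := by
    intro c
    refine hnil.exists_flag _ ?_ (finrank_span_singleton fun h0 => ?_)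
    · rw [Submodule.map_span, Set.image_singleton, Submodule.span_singleton_le_iff_mem]
      simp
    · exact one_ne_zero (LinearIndependent.pair_iff.mp hli 1 c (by rwa [one_smul])).1
  choose F hF1 hmono hinv hrank using hflag
  refine Set.infinite_of_injective_forall_mem (f := fun c (i : Fin (n + 1)) => F c i) ?_ ?_
  · intro c d hcd
    have h1 := congrFun hcd ⟨1, by omega⟩
    simp only [hF1] at h1
    exact hli.injective_span_add_smul h1
  · exact fun c => ⟨fun i => hrank c i (by omega), fun i j hij => hmono c hij, fun i => hinv c i⟩
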